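/- Let (X,→) be a unique path space, let G assign an abelian group G_x to each vertex x and a homomorphism γ_e : G_x → G_y to each edge e : x→y, and fix a vertex z ∈ X. Let D₁ be the direct sum of the groups G_x, indexed by the edges e : x→y such that there is a directed path from y to z, and let D₀ be the direct sum of the groups G_t, indexed by the vertices t such that there is a directed path from t to z. Define ι : D₁ → D₀ on the summand G_x indexed by an edge e : x→y by sending g to (g placed in the summand at x) minus (γ_e(g) placed in the summand at y), and define π : D₀ → G_z on the summand G_t by γ_p, where p is the unique directed path from t to z. Then ι is injective, π is surjective, and ker π = range ι. Moreover the resulting short exact sequence 0 → D₁ → D₀ → G_z → 0 is split: the inclusion s₀ : G_z → D₀ of the summand at z (via the empty path) satisfies π∘s₀ = id, and there exists a homomorphism s₁ : D₀ → D₁ with s₁∘ι = id and s₀∘π + ι∘s₁ = id. -/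

import Mathlib

open scoped DirectSum Classical

/-- The composite of the edge maps of a quiver representation along a directed path
(`AddMonoidHom.id` for the empty path). -/
def pathMap {V : Type} [Quiver V] {G : V → Type} [∀ x, AddCommGroup (G x)]
    (γ : ∀ ⦃x y : V⦄, (x ⟶ y) → (G x →+ G y)) :
    ∀ {x y : V}, Quiver.Path x y → (G x →+ G y)
  | _, _, Quiver.Path.nil => AddMonoidHom.id _
  | _, _, Quiver.Path.cons p e => (γ e).comp (pathMap γ p)

/-- Sum over the edges of a path of the transported element, placed in the summand of the edge. -/
noncomputable def edgeSum {V : Type} [Quiver V] {G : V → Type} [∀ x, AddCommGroup (G x)]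
    (γ : ∀ ⦃x y : V⦄, (x ⟶ y) → (G x →+ G y)) (z : V) :
    ∀ {x y : V}, Quiver.Path x y → Nonempty (Quiver.Path y z) →
      (G x →+ ⨁ e : {e : Σ x y : V, x ⟶ y // Nonempty (Quiver.Path e.2.1 z)}, G e.1.1)
  | _, _, Quiver.Path.nil, _ => 0
  | _, _, @Quiver.Path.cons _ _ _ b c p e, h =>
      edgeSum γ z p (h.map fun q => (Quiver.Hom.toPath e).comp q) +
        (DirectSum.of (fun e : {e : Σ x y : V, x ⟶ y // Nonempty (Quiver.Path e.2.1 z)} =>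
            G e.1.1) ⟨⟨b, c, e⟩, h⟩).comp (pathMap γ p)

theorem pathMap_toPath_comp {V : Type} [Quiver V] {G : V → Type} [∀ x, AddCommGroup (G x)]
    (γ : ∀ ⦃x y : V⦄, (x ⟶ y) → (G x →+ G y)) {x y w : V} (e : x ⟶ y) (p : Quiver.Path y w)
    (g : G x) : pathMap γ ((Quiver.Hom.toPath e).comp p) g = pathMap γ p (γ e g) := by
  induction p with
  | nil => simp [Quiver.Hom.toPath, pathMap]
  | cons p f ih =>
    rw [Quiver.Path.comp_cons]
    simp only [pathMap, AddMonoidHom.comp_apply, ih]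

theorem edgeSum_toPath_comp {V : Type} [Quiver V] {G : V → Type} [∀ x, AddCommGroup (G x)]
    (γ : ∀ ⦃x y : V⦄, (x ⟶ y) → (G x →+ G y)) (z : V) {x y w : V} (e : x ⟶ y)
    (p : Quiver.Path y w) (h : Nonempty (Quiver.Path w z)) (h' : Nonempty (Quiver.Path y z))
    (g : G x) : edgeSum γ z ((Quiver.Hom.toPath e).comp p) h g =
      DirectSum.of (fun e : {e : Σ x y : V, x ⟶ y // Nonempty (Quiver.Path e.2.1 z)} =>
            G e.1.1) ⟨⟨x, y, e⟩, h'⟩ g + edgeSum γ z p h (γ e g) := by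
  induction p with
  | nil =>
    simp [Quiver.Hom.toPath, edgeSum, pathMap]
  | cons p f ih =>
    rw [Quiver.Path.comp_cons]
    simp only [edgeSum, AddMonoidHom.add_apply, AddMonoidHom.comp_apply, ih,
      pathMap_toPath_comp, add_assoc]

/-- Let `(X,→)` be a unique path space, `G` a representation of `X` in
abelian groups, and `z` a vertex.  Let `D₁ = ⊕ G_x`, indexed by the edges `e : x → y`
with a path from `y` to `z`, and `D₀ = ⊕ G_t`, indexed by the `t` with a path from `t`
to `z`.  With `ι : D₁ → D₀` sending `g` in the summand at `e : x → y` to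
`(g at x) − (γ_e g at y)`, and `π : D₀ → G_z` given by `γ_p` on the summand at `t`
(`p` the unique path from `t` to `z`), the sequence `0 → D₁ → D₀ → G_z → 0` is exact,
and it is split: the inclusion `s₀` of the summand at `z` satisfies `π ∘ s₀ = id`, and
there is `s₁ : D₀ → D₁` with `s₁ ∘ ι = id` and `s₀ ∘ π + ι ∘ s₁ = id`. -/
theorem unique_path_space_split_resolution_at_vertex
    (V : Type) [Quiver V]
    (hunique : ∀ x y : V, Subsingleton (Quiver.Path x y))
    (G : V → Type) [∀ x, AddCommGroup (G x)]
    (γ : ∀ ⦃x y : V⦄, (x ⟶ y) → (G x →+ G y))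
    (z : V)
    (ι : (⨁ e : {e : Σ x y : V, x ⟶ y // Nonempty (Quiver.Path e.2.1 z)}, G e.1.1) →+
         (⨁ t : {t : V // Nonempty (Quiver.Path t z)}, G t.1))
    (π : (⨁ t : {t : V // Nonempty (Quiver.Path t z)}, G t.1) →+ G z)
    (hι : ∀ (e : {e : Σ x y : V, x ⟶ y // Nonempty (Quiver.Path e.2.1 z)}) (g : G e.1.1),
      ι (DirectSum.of (fun e : {e : Σ x y : V, x ⟶ y // Nonempty (Quiver.Path e.2.1 z)} =>
            G e.1.1) e g)
        = DirectSum.of (fun t : {t : V // Nonempty (Quiver.Path t z)} => G t.1)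
            ⟨e.1.1, e.2.map fun p => (Quiver.Hom.toPath e.1.2.2).comp p⟩ g
          - DirectSum.of (fun t : {t : V // Nonempty (Quiver.Path t z)} => G t.1)
              ⟨e.1.2.1, e.2⟩ (γ e.1.2.2 g))
    (hπ : ∀ (t : {t : V // Nonempty (Quiver.Path t z)}) (p : Quiver.Path t.1 z) (g : G t.1),
      π (DirectSum.of (fun t : {t : V // Nonempty (Quiver.Path t z)} => G t.1) t g)
        = pathMap γ p g) :
    Function.Injective ι ∧ Function.Surjective π ∧ π.ker = ι.range ∧
    (∀ g : G z,
      π (DirectSum.of (fun t : {t : V // Nonempty (Quiver.Path t z)} => G t.1)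
          ⟨z, ⟨Quiver.Path.nil⟩⟩ g) = g) ∧
    ∃ s₁ : (⨁ t : {t : V // Nonempty (Quiver.Path t z)}, G t.1) →+
           (⨁ e : {e : Σ x y : V, x ⟶ y // Nonempty (Quiver.Path e.2.1 z)}, G e.1.1),
      s₁.comp ι = AddMonoidHom.id _ ∧
      ∀ v : ⨁ t : {t : V // Nonempty (Quiver.Path t z)}, G t.1,
        DirectSum.of (fun t : {t : V // Nonempty (Quiver.Path t z)} => G t.1)
            ⟨z, ⟨Quiver.Path.nil⟩⟩ (π v) + ι (s₁ v) = v := by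
  have hι' : ∀ {x y : V} (p : Quiver.Path x y) (h : Nonempty (Quiver.Path y z))
      (hx : Nonempty (Quiver.Path x z)) (g : G x),
      ι (edgeSum γ z p h g) =
        DirectSum.of (fun t : {t : V // Nonempty (Quiver.Path t z)} => G t.1) ⟨x, hx⟩ g -
        DirectSum.of (fun t : {t : V // Nonempty (Quiver.Path t z)} => G t.1) ⟨y, h⟩
          (pathMap γ p g) := by
    intro x y p
    induction p with
    | nil => intro h hx g; simp [edgeSum, pathMap]
    | cons p f ih =>
      intro h hx g
      simp only [edgeSum, AddMonoidHom.add_apply, AddMonoidHom.comp_apply, map_add, pathMap]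
      rw [ih _ hx, hι]
      simp only
      abel
  have hs₀ : ∀ g : G z,
      π (DirectSum.of (fun t : {t : V // Nonempty (Quiver.Path t z)} => G t.1)
          ⟨z, ⟨Quiver.Path.nil⟩⟩ g) = g := by
    intro g
    rw [hπ ⟨z, ⟨Quiver.Path.nil⟩⟩ Quiver.Path.nil g]
    simp [pathMap]
  let s₁ : (⨁ t : {t : V // Nonempty (Quiver.Path t z)}, G t.1) →+
           (⨁ e : {e : Σ x y : V, x ⟶ y // Nonempty (Quiver.Path e.2.1 z)}, G e.1.1) :=
    DirectSum.toAddMonoid fun t => edgeSum γ z t.2.some ⟨Quiver.Path.nil⟩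
  have hs₁ : ∀ (t : {t : V // Nonempty (Quiver.Path t z)}) (p : Quiver.Path t.1 z) (g : G t.1),
      s₁ (DirectSum.of (fun t : {t : V // Nonempty (Quiver.Path t z)} => G t.1) t g) =
        edgeSum γ z p ⟨Quiver.Path.nil⟩ g := by
    intro t p g
    rw [(hunique t.1 z).elim p t.2.some]
    simp only [s₁, DirectSum.toAddMonoid_of]
  have h1 : s₁.comp ι = AddMonoidHom.id _ := by
    refine DirectSum.addHom_ext fun e g => ?_
    obtain ⟨⟨x, y, e⟩, ⟨p⟩⟩ := e
    rw [AddMonoidHom.comp_apply, hι, map_sub, hs₁ _ ((Quiver.Hom.toPath e).comp p), hs₁ _ p,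
      edgeSum_toPath_comp γ z e p _ ⟨p⟩]
    simp
  have h2 : ∀ v : ⨁ t : {t : V // Nonempty (Quiver.Path t z)}, G t.1,
        DirectSum.of (fun t : {t : V // Nonempty (Quiver.Path t z)} => G t.1)
            ⟨z, ⟨Quiver.Path.nil⟩⟩ (π v) + ι (s₁ v) = v := by
    intro v
    induction v using DirectSum.induction_on with
    | zero => simp
    | of t g =>
      obtain ⟨t, ⟨p⟩⟩ := t
      rw [hπ _ p, hs₁ _ p, hι' p _ ⟨p⟩]
      abel
    | add v w hv hw =>
      simp only [map_add]
      nth_rewrite 3 [← hv]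
      nth_rewrite 3 [← hw]
      abel
  have h3 : ∀ d, π (ι d) = 0 := by
    intro d
    induction d using DirectSum.induction_on with
    | zero => simp
    | of e g =>
      obtain ⟨⟨x, y, e⟩, ⟨p⟩⟩ := e
      rw [hι, map_sub, hπ _ ((Quiver.Hom.toPath e).comp p), hπ _ p, pathMap_toPath_comp, sub_self]
    | add v w hv hw => simp [hv, hw]
  refine ⟨fun a b hab => ?_, fun g => ⟨_, hs₀ g⟩, ?_, hs₀, s₁, h1, h2⟩
  · have := congrArg s₁ hab
    rwa [← AddMonoidHom.comp_apply, ← AddMonoidHom.comp_apply, h1] at this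
  · ext v
    rw [AddMonoidHom.mem_ker, AddMonoidHom.mem_range]
    constructor
    · intro hv
      refine ⟨s₁ v, ?_⟩
      have := h2 v
      rwa [hv, map_zero, zero_add] at this
    · rintro ⟨d, rfl⟩
      exact h3 d
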